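/- Under the standing hypotheses (with K contained in D_e): the center of the division subring D_H = ⊕_{h ∈ H} D_h equals L, and the centralizer C of D_e in D_H is a simple ring whose center is L and whose dimension as an L-vector space is |H|. -/

import Mathlib

variable {G : Type*} [Group G] [DecidableEq G] {D : Type*} [DivisionRing D]

/-- A faithful `G`-grading on `D`: a family of additive subgroups forming an internal
direct sum decomposition, multiplicative, with all components nonzero. -/
structure IsFaithfulGrading (𝒜 : G → AddSubgroup D) : Prop where
  one_mem : (1 : D) ∈ 𝒜 1
  mul_mem : ∀ {g h : G} {x y : D}, x ∈ 𝒜 g → y ∈ 𝒜 h → x * y ∈ 𝒜 (g * h)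
  isInternal : DirectSum.IsInternal 𝒜
  faithful : ∀ g, 𝒜 g ≠ ⊥

/-- `L`, the center of the identity component `D_e`, as a set. -/
def Lset (𝒜 : G → AddSubgroup D) : Set D := {x | x ∈ 𝒜 1 ∧ ∀ y ∈ 𝒜 1, x * y = y * x}

/-- The kernel of the conjugation action of `G` on `L`, as a set:
`{g ∈ G : x·l = l·x for every x ∈ D_g and every l ∈ L}`. -/
def Hset (𝒜 : G → AddSubgroup D) : Set G := {g | ∀ x ∈ 𝒜 g, ∀ l ∈ Lset 𝒜, x * l = l * x}

/-- The identity component `D_e` as a subring of `D`. -/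
def De (𝒜 : G → AddSubgroup D) (hG : IsFaithfulGrading 𝒜) : Subring D where
  carrier := 𝒜 1
  zero_mem' := zero_mem _
  one_mem' := hG.one_mem
  add_mem' := fun ha hb => add_mem ha hb
  neg_mem' := fun ha => neg_mem ha
  mul_mem' := fun ha hb => by simpa using hG.mul_mem ha hb

/-- `L`, the center of the identity component, as a subring of `D`. -/
def Lring (𝒜 : G → AddSubgroup D) (hG : IsFaithfulGrading 𝒜) : Subring D where
  carrier := Lset 𝒜
  zero_mem' := ⟨zero_mem _, fun y _ => by rw [zero_mul, mul_zero]⟩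
  one_mem' := ⟨hG.one_mem, fun y _ => by rw [one_mul, mul_one]⟩
  add_mem' := fun ha hb => ⟨add_mem ha.1 hb.1, fun y hy => by
    rw [add_mul, mul_add, ha.2 y hy, hb.2 y hy]⟩
  neg_mem' := fun ha => ⟨neg_mem ha.1, fun y hy => by rw [neg_mul, mul_neg, ha.2 y hy]⟩
  mul_mem' := fun {a b} ha hb => ⟨by simpa using hG.mul_mem ha.1 hb.1,
    fun y hy => by rw [mul_assoc, hb.2 y hy, ← mul_assoc, ha.2 y hy, mul_assoc]⟩

lemma Lring_le_De (𝒜 : G → AddSubgroup D) (hG : IsFaithfulGrading 𝒜) :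
    Lring 𝒜 hG ≤ De 𝒜 hG := fun _ hx => hx.1

/-- `dim_L D_e`, the dimension of the identity component over its center `L`. -/
noncomputable def dimLDe (𝒜 : G → AddSubgroup D) (hG : IsFaithfulGrading 𝒜) : ℕ :=
  letI : Module ↥(Lring 𝒜 hG) ↥(De 𝒜 hG) :=
    (Subring.inclusion (Lring_le_De 𝒜 hG)).toModule
  Module.finrank ↥(Lring 𝒜 hG) ↥(De 𝒜 hG)

/-- `D_N`, the sum `⊕_{n ∈ N} D_n` of the homogeneous components over a subset `N` of
`G`, as an additive subgroup of `D`. -/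
def DN (𝒜 : G → AddSubgroup D) (N : Set G) : AddSubgroup D := ⨆ g : N, 𝒜 (g : G)

lemma DN_mul_mem (𝒜 : G → AddSubgroup D) (hG : IsFaithfulGrading 𝒜) {N : Set G}
    (hN : ∀ a ∈ N, ∀ b ∈ N, a * b ∈ N) {x y : D}
    (hx : x ∈ DN 𝒜 N) (hy : y ∈ DN 𝒜 N) : x * y ∈ DN 𝒜 N := by
  refine AddSubgroup.iSup_induction (C := fun x => x * y ∈ DN 𝒜 N) _ hx ?_
    (by simp [zero_mem]) ?_
  · intro i a ha
    refine AddSubgroup.iSup_induction (C := fun y => a * y ∈ DN 𝒜 N) _ hy ?_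
      (by simp [zero_mem]) ?_
    · intro j b hb
      exact AddSubgroup.mem_iSup_of_mem (⟨(i : G) * (j : G), hN _ i.2 _ j.2⟩ : N)
        (hG.mul_mem ha hb)
    · intro u v hu hv; rw [mul_add]; exact add_mem hu hv
  · intro u v hu hv; rw [add_mul]; exact add_mem hu hv

/-- `D_N` as a subring of `D`, for `N` a subgroup of `G`. -/
def DNsub (𝒜 : G → AddSubgroup D) (hG : IsFaithfulGrading 𝒜) (N : Subgroup G) :
    Subring D where
  carrier := DN 𝒜 (N : Set G)
  zero_mem' := zero_mem _
  one_mem' := AddSubgroup.mem_iSup_of_mem (⟨1, N.one_mem⟩ : (N : Set G)) hG.one_mem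
  add_mem' := fun ha hb => add_mem ha hb
  neg_mem' := fun ha => neg_mem ha
  mul_mem' := fun ha hb => DN_mul_mem 𝒜 hG (fun _ ha _ hb => N.mul_mem ha hb) ha hb

/-- `C`, the centralizer of `D_e` in `D_H`, as a subring of `D`. -/
def Csub (𝒜 : G → AddSubgroup D) (hG : IsFaithfulGrading 𝒜) (H : Subgroup G) :
    Subring D :=
  Subring.centralizer ((𝒜 1 : AddSubgroup D) : Set D) ⊓ DNsub 𝒜 hG H

lemma Lring_le_Csub (𝒜 : G → AddSubgroup D) (hG : IsFaithfulGrading 𝒜) (H : Subgroup G) :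
    Lring 𝒜 hG ≤ Csub 𝒜 hG H := fun x hx => Subring.mem_inf.mpr
  ⟨Subring.mem_centralizer_iff.mpr (fun y hy => (hx.2 y hy).symm),
    AddSubgroup.mem_iSup_of_mem (⟨1, H.one_mem⟩ : ((H : Set G))) hx.1⟩

/-- `dim_L C`, the dimension of the centralizer of `D_e` in `D_H` over `L`. -/
noncomputable def dimLC (𝒜 : G → AddSubgroup D) (hG : IsFaithfulGrading 𝒜)
    (H : Subgroup G) : ℕ :=
  letI : Module ↥(Lring 𝒜 hG) ↥(Csub 𝒜 hG H) :=
    (Subring.inclusion (Lring_le_Csub 𝒜 hG H)).toModule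
  Module.finrank ↥(Lring 𝒜 hG) ↥(Csub 𝒜 hG H)

theorem indep_lem {K D : Type*} [Field K] [DivisionRing D] [Algebra K D]
    (hc : ∀ x : D, (∀ y, x * y = y * x) → ∃ k : K, algebraMap K D k = x)
    {ι : Type*} (b : ι → D) (hb : LinearIndependent K b) (s : Finset ι) :
    ∀ a : ι → D, (∀ x, ∑ i ∈ s, a i * x * b i = 0) → ∀ i ∈ s, a i = 0 := by
  classical
  induction s using Finset.induction_on with
  | empty => simp
  | insert j s hj ih =>
    intro a ha
    by_cases h0 : a j = 0
    · intro i hi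
      rcases Finset.mem_insert.1 hi with rfl | hi
      · exact h0
      · refine ih a (fun x => ?_) i hi
        have := ha x
        rw [Finset.sum_insert hj] at this
        simpa [h0] using this
    · exfalso
      -- normalise
      have h1 : ∀ x, ∑ i ∈ s, ((a j)⁻¹ * a i) * x * b i = - (x * b j) := by
        intro x
        have := congrArg (fun z => (a j)⁻¹ * z) (ha x)
        simp only [Finset.sum_insert hj, mul_add, Finset.mul_sum, mul_zero] at this
        rw [eq_neg_iff_add_eq_zero, add_comm, ← this]
        congr 1
        · simp [← mul_assoc, h0]
        · simp [mul_assoc]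
      have h2 : ∀ i ∈ s, ∀ y, ((a j)⁻¹ * a i) * y = y * ((a j)⁻¹ * a i) := by
        intro i hi y
        rw [← sub_eq_zero]
        refine ih (fun i => ((a j)⁻¹ * a i) * y - y * ((a j)⁻¹ * a i)) (fun x => ?_) i hi
        have e1 := h1 (y * x)
        have e2 := congrArg (fun z => y * z) (h1 x)
        simp only [Finset.mul_sum] at e2
        simp only [sub_mul, Finset.sum_sub_distrib]
        rw [sub_eq_zero]
        simp only [mul_assoc] at e1 e2 ⊢
        rw [e1, e2]; simp
      choose! k hk using fun i (hi : i ∈ s) => hc _ (h2 i hi)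
      have h3 := h1 1
      have h4 := linearIndependent_iff'.1 hb (insert j s) (fun i => if i = j then 1 else k i) (by
        rw [Finset.sum_insert hj]
        have : ∑ i ∈ s, (if i = j then (1:K) else k i) • b i = - b j := by
          rw [← one_mul (b j), ← h3]
          refine Finset.sum_congr rfl fun i hi => ?_
          have : i ≠ j := by rintro rfl; exact hj hi
          simp [this, Algebra.smul_def, hk i hi]
        rw [this]; simp) j (Finset.mem_insert_self _ _)
      simp at h4

theorem sub_inv_mem {K D : Type*} [Field K] [DivisionRing D] [Algebra K D] [Module.Finite K D]
    (E : Subalgebra K D) {x : D} (hx : x ∈ E) : x⁻¹ ∈ E := by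
  by_cases h : x = 0
  · simp [h]
  let _ : DivisionRing E := divisionRingOfFiniteDimensional K E
  have h1 : (⟨x, hx⟩ : E) ≠ 0 := by simpa [Subtype.ext_iff] using h
  have h2 := congrArg Subtype.val (mul_inv_cancel₀ h1)
  have : x⁻¹ = ((⟨x, hx⟩ : E)⁻¹ : E) := inv_eq_of_mul_eq_one_right h2
  rw [this]; exact Subtype.property _

theorem finrank_centralizer {K D : Type*} [Field K] [DivisionRing D] [Algebra K D]
    [Module.Finite K D]
    (hc : ∀ x : D, (∀ y, x * y = y * x) → ∃ k : K, algebraMap K D k = x)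
    (E : Subalgebra K D) :
    Module.finrank K E * Module.finrank K (Subalgebra.centralizer K (E : Set D)) =
      Module.finrank K D := by
  classical
  let _ : DivisionRing E := divisionRingOfFiniteDimensional K E
  let b := Module.finBasis K D
  have hind := indep_lem hc b b.linearIndependent Finset.univ
  let Ψ : (Fin (Module.finrank K D) → D) →ₗ[K] (D →ₗ[K] D) :=
    { toFun := fun a => ∑ i, (LinearMap.mulRight K (b i)) ∘ₗ (LinearMap.mulLeft K (a i))
      map_add' := by
        intro x y; ext z; simp [add_mul, Finset.sum_add_distrib]
      map_smul' := by
        intro x y; ext z; simp [Finset.smul_sum] }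
  have hΨ : ∀ a x, Ψ a x = ∑ i, a i * x * b i := by intro a x; simp [Ψ]
  have Ψinj : Function.Injective Ψ := by
    rw [← LinearMap.ker_eq_bot, LinearMap.ker_eq_bot']
    intro a ha
    funext i
    exact hind a (fun x => by rw [← hΨ, ha]; rfl) i (Finset.mem_univ _)
  have Ψsurj : Function.Surjective Ψ := by
    refine (LinearMap.injective_iff_surjective_of_finrank_eq_finrank ?_).1 Ψinj
    rw [Module.finrank_linearMap, Module.finrank_pi_fintype]; simp
  let C := Subalgebra.centralizer K (E : Set D)
  have hC : ∀ x, x ∈ C ↔ ∀ e ∈ E, e * x = x * e := fun x => Subalgebra.mem_centralizer_iff K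
  let Φ : (Fin (Module.finrank K D) → C) →ₗ[K] (D →ₗ[E] D) :=
    { toFun := fun a =>
        { toFun := fun x => ∑ i, (a i : D) * x * b i
          map_add' := by intro x y; simp [mul_add, add_mul, Finset.sum_add_distrib]
          map_smul' := by
            intro e x
            simp only [Subalgebra.smul_def, smul_eq_mul, RingHom.id_apply, Finset.mul_sum]
            refine Finset.sum_congr rfl fun i _ => ?_
            simp only [← mul_assoc]
            rw [(hC _).1 (a i).2 e e.2] }
      map_add' := by
        intro x y; ext z; simp [add_mul, Finset.sum_add_distrib]
      map_smul' := by
        intro x y; ext z; simp [Finset.smul_sum] }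
  have hΦ : ∀ a x, Φ a x = ∑ i, (a i : D) * x * b i := by intro a x; simp [Φ]
  have Φbij : Function.Bijective Φ := by
    constructor
    · rw [← LinearMap.ker_eq_bot, LinearMap.ker_eq_bot']
      intro a ha
      funext i
      exact Subtype.ext (hind (fun i => (a i : D)) (fun x => by rw [← hΦ, ha]; rfl) i (Finset.mem_univ _))
    · intro f
      obtain ⟨a, ha⟩ := Ψsurj (f.restrictScalars K)
      have hf : ∀ x, f x = ∑ i, a i * x * b i := by
        intro x; rw [← hΨ, ha]; rfl
      have hmem : ∀ i, a i ∈ C := by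
        intro i
        rw [hC]
        intro e he
        rw [← sub_eq_zero]
        refine hind (fun i => e * a i - a i * e) (fun x => ?_) i (Finset.mem_univ _)
        have h1 : f (e * x) = e * f x := f.map_smul (⟨e, he⟩ : E) x
        rw [hf, hf, Finset.mul_sum] at h1
        simp only [sub_mul, Finset.sum_sub_distrib]
        rw [sub_eq_zero]
        simp only [mul_assoc] at h1 ⊢
        exact h1.symm
      refine ⟨fun i => ⟨a i, hmem i⟩, ?_⟩
      ext x
      rw [hΦ, hf]
  have e1 := (LinearEquiv.ofBijective Φ Φbij).finrank_eq
  have hfin : Module.Finite E D := Module.Finite.of_restrictScalars_finite K E D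
  have e2 := ((Module.finBasis E D).constr (M' := D) K).finrank_eq
  have e3 := Module.finrank_mul_finrank K E D
  rw [← e2] at e1
  simp only [Module.finrank_pi_fintype, Finset.sum_const, Finset.card_univ, Fintype.card_fin, smul_eq_mul] at e1
  have hpos : 0 < Module.finrank K D := Module.finrank_pos
  have : Module.finrank K C = Module.finrank E D := by
    rw [mul_comm (Module.finrank E D)] at e1
    exact Nat.eq_of_mul_eq_mul_left hpos e1
  rw [← e3]
  congr 1

theorem double_centralizer {K D : Type*} [Field K] [DivisionRing D] [Algebra K D]
    [Module.Finite K D]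
    (hc : ∀ x : D, (∀ y, x * y = y * x) → ∃ k : K, algebraMap K D k = x)
    (E : Subalgebra K D) :
    Subalgebra.centralizer K (Subalgebra.centralizer K (E : Set D) : Set D) = E := by
  symm
  have h1 := finrank_centralizer hc E
  have h2 := finrank_centralizer hc (Subalgebra.centralizer K (E : Set D))
  apply Subalgebra.eq_of_le_of_finrank_eq
  · exact Subalgebra.le_centralizer_centralizer K
  · rw [mul_comm, ← h1] at h2
    have hpos : 0 < Module.finrank K (Subalgebra.centralizer K (E : Set D)) := Module.finrank_pos
    exact (Nat.eq_of_mul_eq_mul_right hpos h2).symm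

section
variable (𝒜 : G → AddSubgroup D)

theorem decomp_exists [Fintype G] (hG : IsFaithfulGrading 𝒜) (x : D) :
    ∃ f : G → D, (∀ g, f g ∈ 𝒜 g) ∧ x = ∑ g, f g := by
  classical
  obtain ⟨y, rfl⟩ := hG.isInternal.2 x
  refine ⟨fun g => y g, fun g => (y g).2, ?_⟩
  rw [DirectSum.coeAddMonoidHom_eq_dfinsuppSum, DFinsupp.sum]
  refine Finset.sum_subset (Finset.subset_univ _) fun g _ hg => ?_
  simpa using hg

theorem decomp_unique [Fintype G] (hG : IsFaithfulGrading 𝒜) (f : G → D) (hf : ∀ g, f g ∈ 𝒜 g)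
    (h : ∑ g, f g = 0) (g : G) : f g = 0 := by
  classical
  let y : DirectSum G (fun g => 𝒜 g) :=
    ∑ g, DirectSum.of (fun g => 𝒜 g) g ⟨f g, hf g⟩
  have hy : DirectSum.coeAddMonoidHom 𝒜 y = 0 := by
    simp only [y, map_sum, DirectSum.coeAddMonoidHom_of]
    exact h
  have hy0 : y = 0 := hG.isInternal.1 (by rw [hy, map_zero])
  have := congrArg (fun z : DirectSum G (fun g => 𝒜 g) => ((z g : 𝒜 g) : D)) hy0
  have h2 : y g = ⟨f g, hf g⟩ := by
    simp only [y]
    rw [DFinsupp.finsetSum_apply]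
    rw [Finset.sum_eq_single g]
    · exact DirectSum.of_eq_same _ _
    · intro b _ hb
      exact DirectSum.of_eq_of_ne _ _ _ hb.symm
    · simp
  simpa [h2] using this

/-- `D_e` as a `K`-subalgebra. -/
def DeAlg (hG : IsFaithfulGrading 𝒜) (hKe : (Subring.center D : Set D) ⊆ 𝒜 1) : Subalgebra (Subring.center D) D :=
  { De 𝒜 hG with algebraMap_mem' := fun r => hKe r.2 }

/-- `L` as a `K`-subalgebra. -/
def LAlg (hG : IsFaithfulGrading 𝒜) (hKe : (Subring.center D : Set D) ⊆ 𝒜 1) : Subalgebra (Subring.center D) D :=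
  { Lring 𝒜 hG with
    algebraMap_mem' := fun r => ⟨hKe r.2, fun y _ => (Subring.mem_center_iff.1 r.2 y).symm⟩ }

theorem comp_inv (hG : IsFaithfulGrading 𝒜) [Module.Finite ↥(Subring.center D) D]
    (hKe : (Subring.center D : Set D) ⊆ 𝒜 1) {g : G} {x : D} (hx : x ∈ 𝒜 g) :
    x⁻¹ ∈ 𝒜 g⁻¹ := by
  by_cases h0 : x = 0
  · simp [h0]
  obtain ⟨⟨z, hz⟩, hzne⟩ := AddSubgroup.ne_bot_iff_exists_ne_zero.1 (hG.faithful g⁻¹)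
  have hz0 : z ≠ 0 := fun h => hzne (Subtype.ext h)
  have h1 : (z * x : D) ∈ DeAlg 𝒜 hG hKe := by
    have := hG.mul_mem hz hx
    rw [inv_mul_cancel] at this
    exact this
  have h2 : ((z : D) * x)⁻¹ ∈ 𝒜 1 := sub_inv_mem _ h1
  have h3 : x⁻¹ = ((z : D) * x)⁻¹ * z := by
    rw [mul_inv_rev, mul_assoc, inv_mul_cancel₀ hz0, mul_one]
  rw [h3]
  simpa using hG.mul_mem h2 hz

theorem mem_DN_of_centralizes [Finite G] (hG : IsFaithfulGrading 𝒜) [Module.Finite ↥(Subring.center D) D]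
    (hKe : (Subring.center D : Set D) ⊆ 𝒜 1) {x : D}
    (hx : ∀ l ∈ Lset 𝒜, l * x = x * l) : x ∈ DN 𝒜 (Hset 𝒜) := by
  have := Fintype.ofFinite G
  obtain ⟨f, hf, rfl⟩ := decomp_exists 𝒜 hG x
  refine sum_mem fun g _ => ?_
  by_cases h0 : f g = 0
  · rw [h0]; exact zero_mem _
  have hcomm : ∀ l ∈ Lset 𝒜, l * f g = f g * l := by
    intro l hl
    rw [← sub_eq_zero]
    refine decomp_unique 𝒜 hG (fun g => l * f g - f g * l) (fun g => ?_) ?_ g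
    · exact sub_mem (by simpa using hG.mul_mem hl.1 (hf g)) (by simpa using hG.mul_mem (hf g) hl.1)
    · rw [Finset.sum_sub_distrib, ← Finset.mul_sum, ← Finset.sum_mul, hx l hl, sub_self]
  have hg : g ∈ Hset 𝒜 := by
    intro y hy l hl
    have h1 : y * (f g)⁻¹ ∈ 𝒜 1 := by
      simpa using hG.mul_mem hy (comp_inv 𝒜 hG hKe (hf g))
    have h2 : y = (y * (f g)⁻¹) * f g := by rw [mul_assoc, inv_mul_cancel₀ h0, mul_one]
    rw [h2, mul_assoc, ← hcomm l hl, ← mul_assoc, ← hl.2 _ h1, mul_assoc]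
  exact AddSubgroup.mem_iSup_of_mem (⟨g, hg⟩ : Hset 𝒜) (hf g)

theorem DN_commutes {x : D} (hx : x ∈ DN 𝒜 (Hset 𝒜)) (l : D) (hl : l ∈ Lset 𝒜) :
    l * x = x * l := by
  refine AddSubgroup.iSup_induction (C := fun x => l * x = x * l) _ hx ?_ (by simp) ?_
  · intro i a ha
    exact (i.2 a ha l hl).symm
  · intro u v hu hv; rw [mul_add, add_mul, hu, hv]

theorem finrank_DN [Finite G] (hG : IsFaithfulGrading 𝒜) [Module.Finite ↥(Subring.center D) D]
    (hKe : (Subring.center D : Set D) ⊆ 𝒜 1) (N : Set G)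
    (S : Submodule (Subring.center D) D) (hS : ∀ x, x ∈ S ↔ x ∈ DN 𝒜 N) :
    Module.finrank (Subring.center D) S =
      Nat.card N * Module.finrank (Subring.center D) (DeAlg 𝒜 hG hKe) := by
  classical
  have := Fintype.ofFinite G
  have hex : ∀ g, ∃ z ∈ 𝒜 g, z ≠ 0 := fun g => by
    obtain ⟨z, hz⟩ := AddSubgroup.ne_bot_iff_exists_ne_zero.1 (hG.faithful g)
    exact ⟨z, z.2, fun h => hz (Subtype.ext h)⟩
  choose z hz hz0 using hex
  let Φ : (N → DeAlg 𝒜 hG hKe) →ₗ[Subring.center D] D :=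
    ∑ g : N, (LinearMap.mulRight (Subring.center D) (z g)) ∘ₗ
      (DeAlg 𝒜 hG hKe).val.toLinearMap ∘ₗ LinearMap.proj g
  have hΦ : ∀ a, Φ a = ∑ g : N, (a g : D) * z g := by intro a; simp [Φ]
  have hmem : ∀ (a : DeAlg 𝒜 hG hKe) g, (a : D) * z g ∈ 𝒜 g := fun a g => by
    simpa using hG.mul_mem (show (a : D) ∈ 𝒜 1 from a.2) (hz g)
  have hinj : Function.Injective Φ := by
    rw [← LinearMap.ker_eq_bot, LinearMap.ker_eq_bot']
    intro a ha
    rw [hΦ] at ha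
    funext g
    let f : G → D := fun g => if h : g ∈ N then (a ⟨g, h⟩ : D) * z g else 0
    have h1 : ∑ g, f g = 0 := by
      rw [← ha, ← Finset.sum_subset (Finset.subset_univ N.toFinset)]
      · rw [← Finset.sum_coe_sort]
        refine Fintype.sum_equiv (Equiv.subtypeEquivRight (by simp)) _ _ ?_
        rintro ⟨g, hg⟩
        have : g ∈ N := by simpa using hg
        simp only [f, this, dite_true]
        rfl
      · intro g _ hg
        have : g ∉ N := by simpa using hg
        simp [f, this]
    have h2 := decomp_unique 𝒜 hG f (fun g => by
      by_cases h : g ∈ N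
      · simpa [f, h] using hmem _ g
      · simp [f, h]) h1 g
    simp [f, hz0] at h2
    simpa using h2
  have hrange : LinearMap.range Φ = S := by
    apply le_antisymm
    · rintro _ ⟨a, rfl⟩
      rw [hS, hΦ]
      exact sum_mem fun g _ => AddSubgroup.mem_iSup_of_mem g (hmem _ _)
    · intro x hx
      rw [hS] at hx
      refine AddSubgroup.iSup_induction (C := fun x => x ∈ LinearMap.range Φ) _ hx ?_
        (zero_mem _) (fun _ _ => add_mem)
      intro g y hy
      have h1 : y * (z g)⁻¹ ∈ 𝒜 1 := by
        simpa using hG.mul_mem hy (comp_inv 𝒜 hG hKe (hz g))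
      refine ⟨Pi.single g (⟨y * (z g)⁻¹, h1⟩ : DeAlg 𝒜 hG hKe), ?_⟩
      rw [hΦ, Finset.sum_eq_single g]
      · simp [mul_assoc, hz0]
      · intro b _ hb
        simp [Pi.single_eq_of_ne hb]
      · simp
  rw [← hrange, LinearMap.finrank_range_of_inj hinj, Module.finrank_pi_fintype]
  simp
end


/-- Under the standing hypotheses with `K ⊆ D_e`: the center of the
division subring `D_H = ⊕_{h ∈ H} D_h` equals `L`, and the centralizer `C` of `D_e` in
`D_H` is a simple ring with center `L` and `dim_L C = |H|`. -/
theorem center_DH_eq_L_and_centralizer_simple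
    [Finite G] [CharZero D]
    (𝒜 : G → AddSubgroup D) (hG : IsFaithfulGrading 𝒜)
    [Module.Finite ↥(Subring.center D) D]
    (hKe : (Subring.center D : Set D) ⊆ 𝒜 1)
    (ζ : D) (hζK : ζ ∈ Subring.center D)
    (hζ : orderOf ζ = Monoid.exponent G)
    (H : Subgroup G) (hHcar : (H : Set G) = Hset 𝒜) (hHn : H.Normal) :
    -- the center of `D_H` equals `L`
    {x : D | x ∈ DN 𝒜 (H : Set G) ∧ ∀ y ∈ DN 𝒜 (H : Set G), x * y = y * x} = Lset 𝒜 ∧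
    -- `C` is a simple ring
    IsSimpleRing ↥(Csub 𝒜 hG H) ∧
    -- the center of `C` is `L`
    {x : D | x ∈ Csub 𝒜 hG H ∧ ∀ y ∈ Csub 𝒜 hG H, x * y = y * x} = Lset 𝒜 ∧
    -- `dim_L C = |H|`
    dimLC 𝒜 hG H = Nat.card H := by
  have hc : ∀ x : D, (∀ y, x * y = y * x) →
      ∃ k : Subring.center D, algebraMap (Subring.center D) D k = x := fun x hx =>
    ⟨⟨x, Subring.mem_center_iff.2 fun y => (hx y).symm⟩, rfl⟩
  rw [hHcar]
  -- `C_D(L) = D_H`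
  have hCL : ∀ x, x ∈ Subalgebra.centralizer (Subring.center D)
      (LAlg 𝒜 hG hKe : Set D) ↔ x ∈ DN 𝒜 (Hset 𝒜) := fun x => by
    rw [Subalgebra.mem_centralizer_iff]
    exact ⟨fun h => mem_DN_of_centralizes 𝒜 hG hKe h, fun h l hl => DN_commutes 𝒜 h l hl⟩
  -- `C = C_D(D_e)`
  have hC : ∀ x, x ∈ Subalgebra.centralizer (Subring.center D)
      (DeAlg 𝒜 hG hKe : Set D) ↔ x ∈ Csub 𝒜 hG H := fun x => by
    rw [Subalgebra.mem_centralizer_iff, Csub, Subring.mem_inf, Subring.mem_centralizer_iff]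
    refine ⟨fun h => ⟨h, ?_⟩, fun h => h.1⟩
    change x ∈ DN 𝒜 (H : Set G)
    rw [hHcar]
    exact mem_DN_of_centralizes 𝒜 hG hKe fun l hl => h l hl.1
  have hLDN : ∀ x ∈ Lset 𝒜, x ∈ DN 𝒜 (Hset 𝒜) := fun x hx => by
    rw [← hHcar]
    exact AddSubgroup.mem_iSup_of_mem (⟨1, H.one_mem⟩ : (H : Set G)) hx.1
  refine ⟨?_, ?_, ?_, ?_⟩
  · ext x
    constructor
    · rintro ⟨hx, hxc⟩
      change x ∈ LAlg 𝒜 hG hKe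
      rw [← double_centralizer hc (LAlg 𝒜 hG hKe), Subalgebra.mem_centralizer_iff]
      intro y hy
      exact (hxc y ((hCL y).1 hy)).symm
    · intro hx
      exact ⟨hLDN x hx, fun y hy => DN_commutes 𝒜 hy x hx⟩
  · let S := Subalgebra.centralizer (Subring.center D) (DeAlg 𝒜 hG hKe : Set D)
    have hS : S.toSubring = Csub 𝒜 hG H := by ext x; exact hC x
    rw [← hS]
    let _ : DivisionRing S := divisionRingOfFiniteDimensional (Subring.center D) S
    exact (inferInstance : IsSimpleRing S)
  · ext x
    constructor
    · rintro ⟨hx, hxc⟩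
      have h1 : x ∈ DeAlg 𝒜 hG hKe := by
        rw [← double_centralizer hc (DeAlg 𝒜 hG hKe), Subalgebra.mem_centralizer_iff]
        intro y hy
        exact (hxc y ((hC y).1 hy)).symm
      refine ⟨h1, fun y hy => ?_⟩
      have := (hC x).2 hx
      rw [Subalgebra.mem_centralizer_iff] at this
      exact (this y hy).symm
    · intro hx
      refine ⟨Lring_le_Csub 𝒜 hG H hx, fun y hy => ?_⟩
      refine DN_commutes 𝒜 ?_ x hx
      rw [← hHcar]
      exact (Subring.mem_inf.1 hy).2
  · have d1 := finrank_centralizer hc (DeAlg 𝒜 hG hKe)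
    have d2 := finrank_centralizer hc (LAlg 𝒜 hG hKe)
    have d3 := finrank_DN 𝒜 hG hKe (Hset 𝒜) (Subalgebra.toSubmodule
      (Subalgebra.centralizer (Subring.center D) (LAlg 𝒜 hG hKe : Set D))) hCL
    let K := Subring.center D
    let S := Subalgebra.centralizer (Subring.center D) (DeAlg 𝒜 hG hKe : Set D)
    unfold dimLC
    let _ : Module ↥(Lring 𝒜 hG) ↥(Csub 𝒜 hG H) :=
      (Subring.inclusion (Lring_le_Csub 𝒜 hG H)).toModule
    let _ : Module K ↥(Lring 𝒜 hG) := inferInstanceAs (Module K (LAlg 𝒜 hG hKe))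
    have hKC : Subring.center D ≤ Csub 𝒜 hG H := fun x hx =>
      (hC x).1 (S.algebraMap_mem ⟨x, hx⟩)
    let _ : Module K ↥(Csub 𝒜 hG H) := (Subring.inclusion hKC).toModule
    let iL : DivisionRing (LAlg 𝒜 hG hKe) :=
      divisionRingOfFiniteDimensional K (LAlg 𝒜 hG hKe)
    have _ : StrongRankCondition ↥(Lring 𝒜 hG) :=
      (inferInstance : StrongRankCondition (LAlg 𝒜 hG hKe))
    have _ : Module.Free ↥(Lring 𝒜 hG) ↥(Csub 𝒜 hG H) :=
      @Module.Free.of_divisionRing (LAlg 𝒜 hG hKe) ↥(Csub 𝒜 hG H) iL _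
        ((Subring.inclusion (Lring_le_Csub 𝒜 hG H)).toModule)
    have _ : Module.Free K ↥(Lring 𝒜 hG) :=
      (inferInstance : Module.Free K (LAlg 𝒜 hG hKe))
    have _ : IsScalarTower K ↥(Lring 𝒜 hG) ↥(Csub 𝒜 hG H) :=
      ⟨fun a b c => Subtype.ext (mul_assoc (a : D) (b : D) (c : D))⟩
    have d4 := Module.finrank_mul_finrank K ↥(Lring 𝒜 hG) ↥(Csub 𝒜 hG H)
    let e : S ≃ₗ[K] ↥(Csub 𝒜 hG H) :=
      { toFun := fun x => ⟨x, (hC x).1 x.2⟩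
        invFun := fun x => ⟨x, (hC x).2 x.2⟩
        map_add' := fun _ _ => rfl
        map_smul' := fun _ _ => rfl
        left_inv := fun _ => rfl
        right_inv := fun _ => rfl }
    have d5 := e.finrank_eq
    have d6 : Module.finrank K ↥(Lring 𝒜 hG) = Module.finrank K (LAlg 𝒜 hG hKe) := rfl
    have p1 : 0 < Module.finrank K (LAlg 𝒜 hG hKe) := Module.finrank_pos
    have p2 : 0 < Module.finrank K (DeAlg 𝒜 hG hKe) := Module.finrank_pos
    have d7 : Nat.card H = Nat.card (Hset 𝒜) := by rw [← hHcar]; rfl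
    rw [d7]
    rw [d6, ← d5] at d4
    have d3' : Module.finrank K (Subalgebra.centralizer (Subring.center D)
      (LAlg 𝒜 hG hKe : Set D)) = Nat.card (Hset 𝒜) * Module.finrank K (DeAlg 𝒜 hG hKe) := d3
    have d1' : Module.finrank K (DeAlg 𝒜 hG hKe) * Module.finrank K S =
      Module.finrank K D := d1
    rw [d3', ← d1', ← d4] at d2
    refine Nat.eq_of_mul_eq_mul_left (Nat.mul_pos p2 p1) ?_
    rw [mul_assoc, ← d2]
    ring
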